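/- The number of 3-flimsy numbers below 2^N is 2^{N−1} − O(2^N·N^{−1/2}); that is, there exists a constant C > 0 such that for all integers N ≥ 1, |#{n : 1 ≤ n < 2^N and s_2(3n) < s_2(n)} − 2^{N−1}| ≤ C·2^N·N^{−1/2}. -/

import Mathlib

open Finset Real

/-- The difference `s₂(3n + c) - s₂(n)`: the change in binary digit sum when `n` is multiplied
by `3` with an incoming carry `c`. -/
def digitSumDiff (c n : ℕ) : ℤ :=
  ((Nat.digits 2 (3 * n + c)).sum : ℤ) - ((Nat.digits 2 n).sum : ℤ)

theorem sum_digits_two_mul (n : ℕ) : (Nat.digits 2 (2 * n)).sum = (Nat.digits 2 n).sum := by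
  rcases Nat.eq_zero_or_pos n with rfl | h
  · simp
  · rw [Nat.digits_def' (by norm_num) (by omega)]
    simp

theorem sum_digits_two_mul_add_one (n : ℕ) :
    (Nat.digits 2 (2 * n + 1)).sum = (Nat.digits 2 n).sum + 1 := by
  rw [Nat.digits_def' (by norm_num) (by omega), List.sum_cons,
    show (2 * n + 1) % 2 = 1 by omega, show (2 * n + 1) / 2 = n by omega, add_comm]

theorem digitSumDiff_zero_even (n : ℕ) : digitSumDiff 0 (2 * n) = digitSumDiff 0 n := by
  unfold digitSumDiff
  rw [show 3 * (2 * n) + 0 = 2 * (3 * n + 0) by ring, sum_digits_two_mul, sum_digits_two_mul]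

theorem digitSumDiff_zero_odd (n : ℕ) : digitSumDiff 0 (2 * n + 1) = digitSumDiff 1 n := by
  unfold digitSumDiff
  rw [show 3 * (2 * n + 1) + 0 = 2 * (3 * n + 1) + 1 by ring, sum_digits_two_mul_add_one,
    sum_digits_two_mul_add_one]
  push_cast
  ring

theorem digitSumDiff_one_even (n : ℕ) : digitSumDiff 1 (2 * n) = digitSumDiff 0 n + 1 := by
  unfold digitSumDiff
  rw [show 3 * (2 * n) + 1 = 2 * (3 * n + 0) + 1 by ring, sum_digits_two_mul_add_one,
    sum_digits_two_mul]
  push_cast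
  ring

theorem digitSumDiff_one_odd (n : ℕ) : digitSumDiff 1 (2 * n + 1) = digitSumDiff 2 n - 1 := by
  unfold digitSumDiff
  rw [show 3 * (2 * n + 1) + 1 = 2 * (3 * n + 2) by ring, sum_digits_two_mul_add_one,
    sum_digits_two_mul]
  push_cast
  ring

theorem digitSumDiff_two_even (n : ℕ) : digitSumDiff 2 (2 * n) = digitSumDiff 1 n := by
  unfold digitSumDiff
  rw [show 3 * (2 * n) + 2 = 2 * (3 * n + 1) by ring, sum_digits_two_mul, sum_digits_two_mul]

theorem digitSumDiff_two_odd (n : ℕ) : digitSumDiff 2 (2 * n + 1) = digitSumDiff 2 n := by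
  unfold digitSumDiff
  rw [show 3 * (2 * n + 1) + 2 = 2 * (3 * n + 2) + 1 by ring, sum_digits_two_mul_add_one,
    sum_digits_two_mul_add_one]
  push_cast
  ring

/-- Complementing the `N` low binary digits of `n` negates `digitSumDiff` up to a bounded error. -/
theorem digitSumDiff_add_complement (N : ℕ) : ∀ n m : ℕ, n + m + 1 = 2 ^ N →
    (0 ≤ digitSumDiff 0 n + digitSumDiff 2 m ∧ digitSumDiff 0 n + digitSumDiff 2 m ≤ 2) ∧
    (0 ≤ digitSumDiff 1 n + digitSumDiff 1 m ∧ digitSumDiff 1 n + digitSumDiff 1 m ≤ 2) := by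
  induction N with
  | zero =>
    intro n m h
    obtain ⟨rfl, rfl⟩ : n = 0 ∧ m = 0 := by simp at h; omega
    simp [digitSumDiff]
  | succ N ih =>
    intro n m h
    rw [pow_succ] at h
    rcases Nat.even_or_odd' n with ⟨a, rfl | rfl⟩
    · obtain ⟨b, rfl⟩ : ∃ b, m = 2 * b + 1 := ⟨(m - 1) / 2, by omega⟩
      have h₁ := ih a b (by omega)
      simp only [digitSumDiff_zero_even, digitSumDiff_two_odd, digitSumDiff_one_even,
        digitSumDiff_one_odd]
      omega
    · obtain ⟨b, rfl⟩ : ∃ b, m = 2 * b := ⟨m / 2, by omega⟩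
      have h₁ := ih a b (by omega)
      have h₂ := ih b a (by omega)
      simp only [digitSumDiff_zero_odd, digitSumDiff_two_even, digitSumDiff_one_even,
        digitSumDiff_one_odd]
      omega

theorem sum_range_two_mul {M : Type*} [AddCommMonoid M] (f : ℕ → M) (m : ℕ) :
    ∑ n ∈ range (2 * m), f n = ∑ n ∈ range m, (f (2 * n) + f (2 * n + 1)) := by
  induction m with
  | zero => simp
  | succ m ih =>
    rw [show 2 * (m + 1) = 2 * m + 1 + 1 by ring, sum_range_succ, sum_range_succ, ih,
      sum_range_succ, add_assoc]

/-- The generating function of `digitSumDiff c` on the integers below `2 ^ N`. -/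
noncomputable def digitSumGen (c N : ℕ) (z : ℂ) : ℂ :=
  ∑ n ∈ range (2 ^ N), z ^ digitSumDiff c n

theorem digitSumGen_zero_succ (N : ℕ) (z : ℂ) :
    digitSumGen 0 (N + 1) z = digitSumGen 0 N z + digitSumGen 1 N z := by
  simp only [digitSumGen, pow_succ', sum_range_two_mul, digitSumDiff_zero_even,
    digitSumDiff_zero_odd, sum_add_distrib]

theorem digitSumGen_one_succ (N : ℕ) {z : ℂ} (hz : z ≠ 0) :
    digitSumGen 1 (N + 1) z = z * digitSumGen 0 N z + z⁻¹ * digitSumGen 2 N z := by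
  simp only [digitSumGen, pow_succ', sum_range_two_mul, digitSumDiff_one_even,
    digitSumDiff_one_odd, sum_add_distrib, zpow_add_one₀ hz, zpow_sub_one₀ hz, sum_mul,
    mul_comm z, mul_comm z⁻¹]

theorem digitSumGen_two_succ (N : ℕ) (z : ℂ) :
    digitSumGen 2 (N + 1) z = digitSumGen 1 N z + digitSumGen 2 N z := by
  simp only [digitSumGen, pow_succ', sum_range_two_mul, digitSumDiff_two_even,
    digitSumDiff_two_odd, sum_add_distrib]

theorem digitSumGen_one_add_two (N : ℕ) {z : ℂ} (hz : z ≠ 0) :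
    digitSumGen 1 (N + 2) z = digitSumGen 1 (N + 1) z + (z + z⁻¹) * digitSumGen 1 N z := by
  rw [digitSumGen_one_succ (N + 1) hz, digitSumGen_zero_succ, digitSumGen_two_succ,
    digitSumGen_one_succ N hz]
  ring

theorem norm_digitSumGen_le (c N : ℕ) {z : ℂ} (hz : ‖z‖ = 1) : ‖digitSumGen c N z‖ ≤ 2 ^ N := by
  refine (norm_sum_le _ _).trans ?_
  simp [norm_zpow, hz]

theorem norm_digitSumGen_one_le {z : ℂ} (hz : ‖z‖ = 1) {t : ℝ} (ht : ‖z + z⁻¹‖ = 2 * t)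
    (N : ℕ) : ‖digitSumGen 1 N z‖ ≤ 3 / 2 * ((4 + 2 * t) / 3) ^ N := by
  have hz₀ : z ≠ 0 := by rintro rfl; simp at hz
  have ht₀ : 0 ≤ t := by have := norm_nonneg (z + z⁻¹); linarith
  induction N using Nat.twoStepInduction with
  | zero => have := norm_digitSumGen_le 1 0 hz; norm_num at this ⊢; linarith
  | one => have := norm_digitSumGen_le 1 1 hz; norm_num at this ⊢; linarith
  | more N ih₀ ih₁ =>
    rw [digitSumGen_one_add_two N hz₀]
    refine (norm_add_le _ _).trans ?_
    rw [norm_mul, ht]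
    have hp : 0 ≤ ((4 + 2 * t) / 3) ^ N := by positivity
    have h₂ := mul_le_mul_of_nonneg_left ih₀ (by positivity : 0 ≤ 2 * t)
    rw [pow_succ] at ih₁ ⊢
    rw [pow_succ]
    nlinarith [mul_nonneg hp (sq_nonneg (1 - t))]

theorem norm_exp_mul_I_add_inv (θ : ℝ) :
    ‖Complex.exp (θ * Complex.I) + (Complex.exp (θ * Complex.I))⁻¹‖ = 2 * |cos θ| := by
  have h : Complex.exp (θ * Complex.I) + (Complex.exp (θ * Complex.I))⁻¹ =
      ((2 * cos θ : ℝ) : ℂ) := by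
    rw [← Complex.exp_neg, ← neg_mul, ← Complex.two_cos]
    push_cast
    rfl
  rw [h, Complex.norm_real, norm_mul]
  simp

theorem abs_cos_le_one_sub_sin_sq (θ : ℝ) : |cos θ| ≤ 1 - sin θ ^ 2 / 2 := by
  have h₁ := sin_sq_add_cos_sq θ
  rw [← sq_abs (cos θ)] at h₁
  nlinarith [sq_nonneg (1 - |cos θ|)]

theorem norm_digitSumGen_exp_le (N : ℕ) (θ : ℝ) :
    ‖digitSumGen 1 N (Complex.exp (θ * Complex.I))‖ ≤
      3 / 2 * 2 ^ N * exp (-(N / 6) * sin θ ^ 2) := by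
  refine (norm_digitSumGen_one_le (Complex.norm_exp_ofReal_mul_I θ)
    (norm_exp_mul_I_add_inv θ) N).trans ?_
  have h : (4 + 2 * |cos θ|) / 3 ≤ 2 * exp (-(sin θ ^ 2 / 6)) := by
    have := add_one_le_exp (-(sin θ ^ 2 / 6))
    linarith [abs_cos_le_one_sub_sin_sq θ]
  calc 3 / 2 * ((4 + 2 * |cos θ|) / 3) ^ N ≤ 3 / 2 * (2 * exp (-(sin θ ^ 2 / 6))) ^ N := by gcongr
    _ = 3 / 2 * 2 ^ N * exp (-(N / 6) * sin θ ^ 2) := by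
      rw [mul_pow, ← exp_nat_mul, mul_assoc]
      congr 3
      ring

theorem exp_neg_mul_sin_sq_le {a : ℝ} (ha : 0 ≤ a) {θ : ℝ} (h : |θ| ≤ π / 2) :
    exp (-a * sin θ ^ 2) ≤ exp (-(4 * a / π ^ 2) * θ ^ 2) := by
  rw [exp_le_exp]
  have h₁ : (2 / π * |θ|) ^ 2 ≤ |sin θ| ^ 2 := by
    gcongr
    exact mul_abs_le_abs_sin h
  rw [sq_abs, mul_pow, sq_abs] at h₁
  have := mul_le_mul_of_nonneg_left h₁ ha
  calc -a * sin θ ^ 2 ≤ -(a * ((2 / π) ^ 2 * θ ^ 2)) := by linarith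
    _ = _ := by ring

theorem integral_exp_neg_mul_sin_sq_le {a : ℝ} (ha : 0 < a) :
    ∫ θ in (-(π / 2))..(3 * π / 2), exp (-a * sin θ ^ 2) ≤ 2 * √(π / (4 * a / π ^ 2)) := by
  set b := 4 * a / π ^ 2 with hb
  have hb₀ : 0 < b := by positivity
  have hi₁ : MeasureTheory.Integrable (fun x : ℝ => exp (-b * x ^ 2)) :=
    integrable_exp_neg_mul_sq hb₀
  have hi₂ : MeasureTheory.Integrable (fun x : ℝ => exp (-b * (x - π) ^ 2)) := hi₁.comp_sub_right π
  have hle : -(π / 2) ≤ 3 * π / 2 := by linarith [pi_pos]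
  calc ∫ θ in (-(π / 2))..(3 * π / 2), exp (-a * sin θ ^ 2)
      ≤ ∫ θ in (-(π / 2))..(3 * π / 2), (exp (-b * θ ^ 2) + exp (-b * (θ - π) ^ 2)) := by
        refine intervalIntegral.integral_mono_on hle
          (Continuous.intervalIntegrable (by fun_prop) _ _)
          (Continuous.intervalIntegrable (by fun_prop) _ _) ?_
        rintro θ ⟨h₁, h₂⟩
        rcases le_total θ (π / 2) with h | h
        · have := exp_neg_mul_sin_sq_le ha.le (abs_le.2 ⟨h₁, h⟩)
          have := exp_pos (-b * (θ - π) ^ 2)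
          linarith
        · have h₃ := exp_neg_mul_sin_sq_le (θ := θ - π) ha.le (abs_le.2 ⟨by linarith, by linarith⟩)
          rw [sin_sub_pi, neg_sq] at h₃
          have := exp_pos (-b * θ ^ 2)
          linarith
    _ ≤ ∫ θ : ℝ, (exp (-b * θ ^ 2) + exp (-b * (θ - π) ^ 2)) := by
        rw [intervalIntegral.integral_of_le hle]
        refine MeasureTheory.setIntegral_le_integral (hi₁.add hi₂) (Filter.Eventually.of_forall ?_)
        intro θ
        positivity
    _ = 2 * √(π / b) := by
        rw [MeasureTheory.integral_add hi₁ hi₂,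
          MeasureTheory.integral_sub_right_eq_self (fun x : ℝ => exp (-b * x ^ 2)) π,
          integral_gaussian]
        ring

theorem integral_exp_int_mul_I (k : ℤ) :
    ∫ θ in (-(π / 2))..(3 * π / 2), Complex.exp (θ * Complex.I) ^ k =
      if k = 0 then (2 * π : ℂ) else 0 := by
  split_ifs with hk
  · subst hk
    simp only [zpow_zero, intervalIntegral.integral_const, Complex.real_smul]
    push_cast
    ring
  · have hc : (k * Complex.I : ℂ) ≠ 0 := by simp [hk]
    have h : ∀ θ : ℝ, Complex.exp (θ * Complex.I) ^ k = Complex.exp (k * Complex.I * θ) := by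
      intro θ
      rw [← Complex.exp_int_mul]
      congr 1
      ring
    simp only [h]
    rw [integral_exp_mul_complex hc]
    have : Complex.exp (k * Complex.I * ((3 * π / 2 : ℝ) : ℂ)) =
        Complex.exp (k * Complex.I * ((-(π / 2) : ℝ) : ℂ)) := by
      rw [Complex.exp_eq_exp_iff_exists_int]
      refine ⟨k, ?_⟩
      push_cast
      ring
    rw [this, sub_self, zero_div]

theorem two_pi_mul_card_eq_integral (c N : ℕ) (j : ℤ) :
    (2 * π : ℂ) * #{n ∈ range (2 ^ N) | digitSumDiff c n = j} =
      ∫ θ in (-(π / 2))..(3 * π / 2),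
        digitSumGen c N (Complex.exp (θ * Complex.I)) * Complex.exp (θ * Complex.I) ^ (-j) := by
  have h : ∀ θ : ℝ, digitSumGen c N (Complex.exp (θ * Complex.I)) *
      Complex.exp (θ * Complex.I) ^ (-j) =
      ∑ n ∈ range (2 ^ N), Complex.exp (θ * Complex.I) ^ (digitSumDiff c n - j) := by
    intro θ
    rw [digitSumGen, sum_mul]
    refine sum_congr rfl fun n _ => ?_
    rw [← zpow_add₀ (Complex.exp_ne_zero _), sub_eq_add_neg]
  simp only [h]
  rw [intervalIntegral.integral_finsetSum]
  · simp only [integral_exp_int_mul_I, sub_eq_zero, ← sum_filter, sum_const, nsmul_eq_mul]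
    ring
  · intro n _
    refine Continuous.intervalIntegrable ?_ _ _
    exact Continuous.zpow₀ (by fun_prop) _ fun θ => Or.inl (Complex.exp_ne_zero _)

/-- Each value of `digitSumDiff 1` is taken by only a proportion `O(N ^ (-1/2))` of the integers
below `2 ^ N`. -/
theorem card_digitSumDiff_one_eq_le (N : ℕ) (j : ℤ) :
    (#{n ∈ range (2 ^ N) | digitSumDiff 1 n = j} : ℝ) ≤ 6 * 2 ^ N / √(N + 1) := by
  rcases Nat.eq_zero_or_pos N with rfl | hN
  · have : #{n ∈ range (2 ^ 0) | digitSumDiff 1 n = j} ≤ 1 :=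
      (card_filter_le _ _).trans (by simp)
    have : (#{n ∈ range (2 ^ 0) | digitSumDiff 1 n = j} : ℝ) ≤ 1 := by exact_mod_cast this
    norm_num at this ⊢
    linarith
  have hN₁ : (1 : ℝ) ≤ N := by exact_mod_cast hN
  have hle : -(π / 2) ≤ 3 * π / 2 := by linarith [pi_pos]
  have h := intervalIntegral.norm_integral_le_of_norm_le (μ := MeasureTheory.volume)
    (f := fun θ : ℝ => digitSumGen 1 N (Complex.exp (θ * Complex.I)) *
      Complex.exp (θ * Complex.I) ^ (-j))
    (g := fun θ : ℝ => 3 / 2 * 2 ^ N * exp (-(N / 6) * sin θ ^ 2)) hle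
    (Filter.Eventually.of_forall fun θ _ => by
      rw [norm_mul, norm_zpow, Complex.norm_exp_ofReal_mul_I, one_zpow, mul_one]
      exact norm_digitSumGen_exp_le N θ)
    (Continuous.intervalIntegrable (by fun_prop) _ _)
  rw [← two_pi_mul_card_eq_integral, intervalIntegral.integral_const_mul] at h
  have h₁ := integral_exp_neg_mul_sin_sq_le (a := N / 6) (by positivity)
  have h₂ : √(π / (4 * (N / 6) / π ^ 2)) ≤ 4 * π / √(N + 1) := by
    rw [le_div_iff₀ (by positivity), ← sqrt_mul (by positivity)]
    refine sqrt_le_iff.2 ⟨by positivity, ?_⟩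
    rw [show π / (4 * (N / 6) / π ^ 2) * (N + 1) = π ^ 2 * (π * (3 * (N + 1) / (2 * N))) by
      field_simp; ring]
    have h₃ : 3 * ((N : ℝ) + 1) / (2 * N) ≤ 3 := by
      rw [div_le_iff₀ (by positivity)]; linarith
    have h₄ : π * (3 * (N + 1) / (2 * N)) ≤ 4 * 3 := by
      gcongr
      exact pi_le_four
    nlinarith [sq_nonneg π]
  have h₅ : ‖(2 * π : ℂ) * #{n ∈ range (2 ^ N) | digitSumDiff 1 n = j}‖ =
      2 * π * #{n ∈ range (2 ^ N) | digitSumDiff 1 n = j} := by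
    simp [abs_of_pos pi_pos]
  rw [h₅] at h
  have h₆ : 2 * π * #{n ∈ range (2 ^ N) | digitSumDiff 1 n = j} ≤
      2 * π * (6 * 2 ^ N / √(N + 1)) := by
    calc _ ≤ 3 / 2 * 2 ^ N * (2 * (4 * π / √(N + 1))) := by
          refine h.trans ?_
          gcongr
          exact h₁.trans (by gcongr)
      _ = _ := by ring
  exact le_of_mul_le_mul_left h₆ (by positivity)

theorem abs_card_digitSumDiff_one_neg_sub_le (N : ℕ) :
    |(#{n ∈ range (2 ^ N) | digitSumDiff 1 n < 0} : ℝ) - 2 ^ N / 2| ≤ 9 * 2 ^ N / √(N + 1) := by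
  have hlt : ∀ n ∈ range (2 ^ N), n + (2 ^ N - 1 - n) + 1 = 2 ^ N := by
    intro n hn; rw [mem_range] at hn; omega
  have hinj : Set.InjOn (fun n => 2 ^ N - 1 - n) (range (2 ^ N) : Set ℕ) := by
    intro a ha b hb hab
    simp only [coe_range, Set.mem_Iio] at ha hb hab
    omega
  have h₁ : #{n ∈ range (2 ^ N) | digitSumDiff 1 n < 0} ≤
      #{n ∈ range (2 ^ N) | 0 < digitSumDiff 1 n} := by
    refine card_le_card_of_injOn (fun n => 2 ^ N - 1 - n) ?_
      (hinj.mono (by exact_mod_cast filter_subset _ _))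
    intro n hn
    simp only [coe_filter, Set.mem_ofPred_eq, mem_range] at hn ⊢
    have := (digitSumDiff_add_complement N _ _ (hlt n (mem_range.2 hn.1))).2
    omega
  have h₂ : #{n ∈ range (2 ^ N) | 2 < digitSumDiff 1 n} ≤
      #{n ∈ range (2 ^ N) | digitSumDiff 1 n < 0} := by
    refine card_le_card_of_injOn (fun n => 2 ^ N - 1 - n) ?_
      (hinj.mono (by exact_mod_cast filter_subset _ _))
    intro n hn
    simp only [coe_filter, Set.mem_ofPred_eq, mem_range] at hn ⊢
    have := (digitSumDiff_add_complement N _ _ (hlt n (mem_range.2 hn.1))).2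
    omega
  have h₃ : #{n ∈ range (2 ^ N) | digitSumDiff 1 n < 0} +
      #{n ∈ range (2 ^ N) | 0 < digitSumDiff 1 n} ≤ 2 ^ N := by
    rw [← card_union_of_disjoint]
    · simpa using card_le_card (union_subset (filter_subset _ (range (2 ^ N)))
        (filter_subset _ (range (2 ^ N))))
    · exact disjoint_filter.2 fun n _ h => by omega
  have h₄ : 2 ^ N ≤ #{n ∈ range (2 ^ N) | digitSumDiff 1 n < 0} +
      #{n ∈ range (2 ^ N) | 2 < digitSumDiff 1 n} +
      #{n ∈ range (2 ^ N) | digitSumDiff 1 n = 0} +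
      #{n ∈ range (2 ^ N) | digitSumDiff 1 n = 1} +
      #{n ∈ range (2 ^ N) | digitSumDiff 1 n = 2} := by
    simp only [card_filter, ← sum_add_distrib]
    calc 2 ^ N = ∑ n ∈ range (2 ^ N), 1 := by simp
      _ ≤ _ := sum_le_sum fun n _ => by split_ifs <;> omega
  have e₀ := card_digitSumDiff_one_eq_le N 0
  have e₁ := card_digitSumDiff_one_eq_le N 1
  have e₂ := card_digitSumDiff_one_eq_le N 2
  have h₅ : 2 * (#{n ∈ range (2 ^ N) | digitSumDiff 1 n < 0} : ℝ) ≤ 2 ^ N := by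
    exact_mod_cast (by omega : 2 * #{n ∈ range (2 ^ N) | digitSumDiff 1 n < 0} ≤ 2 ^ N)
  have h₆ : (2 : ℝ) ^ N ≤ 2 * #{n ∈ range (2 ^ N) | digitSumDiff 1 n < 0} +
      #{n ∈ range (2 ^ N) | digitSumDiff 1 n = 0} +
      #{n ∈ range (2 ^ N) | digitSumDiff 1 n = 1} +
      #{n ∈ range (2 ^ N) | digitSumDiff 1 n = 2} := by
    exact_mod_cast (by omega : 2 ^ N ≤ 2 * #{n ∈ range (2 ^ N) | digitSumDiff 1 n < 0} +
      #{n ∈ range (2 ^ N) | digitSumDiff 1 n = 0} +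
      #{n ∈ range (2 ^ N) | digitSumDiff 1 n = 1} +
      #{n ∈ range (2 ^ N) | digitSumDiff 1 n = 2})
  have h₇ : 9 * 2 ^ N / √((N : ℝ) + 1) = 3 / 2 * (6 * 2 ^ N / √((N : ℝ) + 1)) := by ring
  rw [abs_le, h₇]
  have : 0 ≤ 6 * 2 ^ N / √((N : ℝ) + 1) := by positivity
  constructor <;> linarith

theorem card_digitSumDiff_zero_neg_succ (N : ℕ) :
    #{n ∈ range (2 ^ (N + 1)) | digitSumDiff 0 n < 0} =
      #{n ∈ range (2 ^ N) | digitSumDiff 0 n < 0} +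
        #{n ∈ range (2 ^ N) | digitSumDiff 1 n < 0} := by
  simp only [card_filter, pow_succ', sum_range_two_mul, digitSumDiff_zero_even,
    digitSumDiff_zero_odd, sum_add_distrib]

theorem abs_card_digitSumDiff_zero_neg_sub_le (N : ℕ) :
    |(#{n ∈ range (2 ^ N) | digitSumDiff 0 n < 0} : ℝ) - 2 ^ N / 2| ≤ 27 * 2 ^ N / √(N + 1) := by
  induction N with
  | zero =>
    have : digitSumDiff 0 0 = 0 := by simp [digitSumDiff]
    norm_num [filter_singleton, this]
  | succ N ih =>
    have h := abs_card_digitSumDiff_one_neg_sub_le N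
    rw [card_digitSumDiff_zero_neg_succ]
    have hs : √((N + 1 : ℕ) + 1 : ℝ) ≤ 3 / 2 * √((N : ℝ) + 1) := by
      refine sqrt_le_iff.2 ⟨by positivity, ?_⟩
      rw [mul_pow, sq_sqrt (by positivity)]
      push_cast
      have : (0 : ℝ) ≤ N := by positivity
      linarith
    calc _ = |((#{n ∈ range (2 ^ N) | digitSumDiff 0 n < 0} : ℝ) - 2 ^ N / 2) +
          ((#{n ∈ range (2 ^ N) | digitSumDiff 1 n < 0} : ℝ) - 2 ^ N / 2)| := by
          push_cast
          congr 1
          ring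
      _ ≤ 27 * 2 ^ N / √(N + 1) + 9 * 2 ^ N / √(N + 1) := (abs_add_le _ _).trans (add_le_add ih h)
      _ = 36 * 2 ^ N / √(N + 1) := by ring
      _ ≤ 27 * 2 ^ (N + 1) / √((N + 1 : ℕ) + 1) := by
          rw [div_le_div_iff₀ (by positivity) (by positivity), pow_succ]
          have := mul_le_mul_of_nonneg_left hs (by positivity : (0 : ℝ) ≤ 36 * 2 ^ N)
          linarith

theorem stmt_15 :
    ∃ C : ℝ, 0 < C ∧ ∀ N : ℕ, 1 ≤ N →
      |(((Finset.Ico 1 (2 ^ N)).filter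
            (fun n => (Nat.digits 2 (3 * n)).sum < (Nat.digits 2 n).sum)).card : ℝ) -
          2 ^ (N - 1)| ≤
        C * 2 ^ N * (N : ℝ) ^ (-(1 / 2 : ℝ)) := by
  refine ⟨27, by norm_num, fun N hN => ?_⟩
  have hN₀ : (0 : ℝ) < N := by exact_mod_cast hN
  have hset : (Finset.Ico 1 (2 ^ N)).filter
      (fun n => (Nat.digits 2 (3 * n)).sum < (Nat.digits 2 n).sum) =
      {n ∈ range (2 ^ N) | digitSumDiff 0 n < 0} := by
    ext n
    simp only [mem_filter, mem_Ico, mem_range, digitSumDiff, add_zero, sub_neg, Nat.cast_lt]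
    refine ⟨fun h => ⟨h.1.2, h.2⟩, fun h => ⟨⟨?_, h.1⟩, h.2⟩⟩
    rcases Nat.eq_zero_or_pos n with rfl | hn
    · simp at h
    · exact hn
  have hpow : (2 : ℝ) ^ (N - 1) = 2 ^ N / 2 := by
    obtain ⟨M, rfl⟩ : ∃ M, N = M + 1 := ⟨N - 1, by omega⟩
    rw [Nat.add_sub_cancel, pow_succ]
    ring
  rw [hset, hpow, rpow_neg hN₀.le, ← sqrt_eq_rpow, ← div_eq_mul_inv]
  refine (abs_card_digitSumDiff_zero_neg_sub_le N).trans ?_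
  gcongr
  linarith
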